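/- Let Z = ℓ₁ ⊕₂ ℝ and let F : B_Z → B_Z be a non-expansive bijection of the closed unit ball onto itself. Then there exist an injective map σ : ℕ → ℕ and signs θ : ℕ → {−1, 1} such that F⁻¹(a·e_m, 0) = (a·θ(m)·e_{σ(m)}, 0) for every m ∈ ℕ and every a ∈ [−1, 1]. -/

import Mathlib

/-- The real sequence space ℓ₁. -/
noncomputable abbrev Ell1 : Type := lp (fun _ : ℕ => ℝ) 1

/-- The space Z = ℓ₁ ⊕₂ ℝ, with norm ‖(x,t)‖ = √(‖x‖₁² + t²). -/
noncomputable abbrev Z : Type := WithLp 2 (Ell1 × ℝ)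

/-- The m-th canonical basis vector of ℓ₁. -/
noncomputable def e (m : ℕ) : Ell1 := lp.single 1 m (1 : ℝ)

/-- The element (x, t) of Z = ℓ₁ ⊕₂ ℝ. -/
noncomputable def zmk (x : Ell1) (t : ℝ) : Z := (WithLp.equiv 2 (Ell1 × ℝ)).symm (x, t)

lemma aux_fst (x : Ell1) (t : ℝ) : (zmk x t).fst = x := rfl
lemma aux_snd (x : Ell1) (t : ℝ) : (zmk x t).snd = t := rfl

lemma aux_sq (z : Z) : ‖z‖ ^ 2 = ‖z.fst‖ ^ 2 + z.snd ^ 2 := by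
  rw [WithLp.prod_norm_sq_eq_of_L2, Real.norm_eq_abs, sq_abs]

lemma aux_ext {z w : Z} (h1 : z.fst = w.fst) (h2 : z.snd = w.snd) : z = w :=
  (WithLp.equiv 2 (Ell1 × ℝ)).injective (Prod.ext h1 h2)

lemma aux_split (x : Ell1) (i : ℕ) : ‖x - x i • e i‖ = ‖x‖ - |x i| := by
  have h := lp.norm_sub_norm_compl_sub_single (p := 1) (E := fun _ : ℕ => ℝ) (by simp) x {i}
  have h2 : x i • e i = lp.single 1 i (x i) := by
    rw [e, ← lp.single_smul]; simp
  rw [h2]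
  simp at h
  linarith

lemma aux_e_self (i : ℕ) : (e i) i = 1 := by
  simp [e]

lemma aux_norm_e (i : ℕ) : ‖e i‖ = 1 := by
  have := lp.norm_single (p := 1) (E := fun _ : ℕ => ℝ) (by norm_num) i (1 : ℝ)
  simpa [e] using this

lemma aux_A1 (y : Ell1) (n : ℕ) (c : ℝ) (h1 : ‖y - e n‖ ≤ 1 - c) (h2 : ‖y + e n‖ ≤ 1 + c) :
    y = c • e n := by
  have a1 := aux_split (y - e n) n
  have a2 := aux_split (y + e n) n
  have k1 : (y - e n) n = y n - 1 := by
    rw [lp.coeFn_sub, Pi.sub_apply, aux_e_self]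
  have k2 : (y + e n) n = y n + 1 := by
    rw [lp.coeFn_add, Pi.add_apply, aux_e_self]
  rw [k1] at a1
  rw [k2] at a2
  have m1 : y - e n - (y n - 1) • e n = y - y n • e n := by module
  have m2 : y + e n - (y n + 1) • e n = y - y n • e n := by module
  rw [m1] at a1
  rw [m2] at a2
  have p := norm_nonneg (y - y n • e n)
  have b1 := neg_abs_le (y n - 1)
  have b2 := le_abs_self (y n + 1)
  have r0 : ‖y - y n • e n‖ = 0 := by linarith
  have yc : y n = c := by linarith
  rw [norm_eq_zero, sub_eq_zero, yc] at r0
  exact r0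

lemma aux_A (z : Z) (n : ℕ) (c : ℝ) (h1 : ‖z - zmk (e n) 0‖ ≤ 1 - c)
    (h2 : ‖z - zmk (-e n) 0‖ ≤ 1 + c) : z = zmk (c • e n) 0 := by
  have s1 := aux_sq (z - zmk (e n) 0)
  have s2 := aux_sq (z - zmk (-e n) 0)
  simp only [WithLp.sub_fst, WithLp.sub_snd, aux_fst, aux_snd, sub_zero, sub_neg_eq_add] at s1 s2
  have q1 : ‖z.fst - e n‖ ≤ ‖z - zmk (e n) 0‖ :=
    abs_le_of_sq_le_sq' (by nlinarith [sq_nonneg z.snd]) (norm_nonneg _) |>.2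
  have q2 : ‖z.fst + e n‖ ≤ ‖z - zmk (-e n) 0‖ :=
    abs_le_of_sq_le_sq' (by nlinarith [sq_nonneg z.snd]) (norm_nonneg _) |>.2
  have hz := aux_A1 z.fst n c (q1.trans h1) (q2.trans h2)
  have hc : 0 ≤ 1 - c := (norm_nonneg _).trans h1
  have hn : ‖z.fst - e n‖ = 1 - c := by
    rw [hz, show c • e n - e n = -((1 - c) • e n) by module, norm_neg, norm_smul, aux_norm_e,
      Real.norm_of_nonneg hc, mul_one]
  refine aux_ext hz ?_
  rw [aux_snd]
  rw [hn] at s1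
  have := norm_nonneg (z - zmk (e n) 0)
  have : z.snd ^ 2 ≤ 0 := by nlinarith
  exact pow_eq_zero_iff (two_ne_zero) |>.1 (le_antisymm this (sq_nonneg _))

lemma aux_B (u v : Z) (hu : ‖u‖ ≤ 1) (hv : ‖v‖ ≤ 1) (h : 2 ≤ ‖u - v‖) : u.snd + v.snd = 0 := by
  have s1 := aux_sq u
  have s2 := aux_sq v
  have s3 := aux_sq (u - v)
  rw [WithLp.sub_fst, WithLp.sub_snd] at s3
  have t := norm_sub_le u.fst v.fst
  have p := norm_nonneg (u.fst - v.fst)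
  have pu := norm_nonneg u
  have pv := norm_nonneg v
  have t2 : ‖u.fst - v.fst‖ ^ 2 ≤ (‖u.fst‖ + ‖v.fst‖) ^ 2 := by gcongr
  have : (u.snd + v.snd) ^ 2 ≤ 0 := by
    nlinarith [sq_nonneg (‖u.fst‖ - ‖v.fst‖)]
  exact pow_eq_zero_iff (two_ne_zero) |>.1 (le_antisymm this (sq_nonneg _))

lemma aux_norm0 (x : Ell1) : ‖zmk x 0‖ = ‖x‖ := by
  have := aux_sq (zmk x 0)
  rw [aux_fst, aux_snd] at this
  have h : ‖zmk x 0‖ ^ 2 = ‖x‖ ^ 2 := by linarith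
  exact (sq_eq_sq₀ (norm_nonneg _) (norm_nonneg _)).1 h

lemma aux_sub0 (x y : Ell1) : zmk x 0 - zmk y 0 = zmk (x - y) 0 :=
  aux_ext rfl (by simp [aux_snd])

lemma aux_dist_e (n m : ℕ) (h : n ≠ m) (s : ℝ) (hs : |s| = 1) : ‖e n - s • e m‖ = 2 := by
  have a := aux_split (e n - s • e m) n
  have k : (e n - s • e m) n = 1 := by
    rw [lp.coeFn_sub, Pi.sub_apply, aux_e_self, lp.coeFn_smul, Pi.smul_apply]
    have : (e m) n = 0 := by simp [e, lp.single_apply, h]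
    simp [this]
  rw [k, show e n - s • e m - (1 : ℝ) • e n = -(s • e m) by module, norm_neg, norm_smul,
    aux_norm_e, Real.norm_eq_abs, hs] at a
  simp at a
  linarith

lemma aux_main (F : Z → Z) (hbij : Set.BijOn F (Metric.closedBall 0 1) (Metric.closedBall 0 1))
    (hne : LipschitzOnWith 1 F (Metric.closedBall 0 1)) (n : ℕ) :
    ∃ (i : ℕ) (s : ℝ), (s = 1 ∨ s = -1) ∧
      ∀ a ∈ Set.Icc (-1 : ℝ) 1, F (zmk ((a * s) • e i) 0) = zmk (a • e n) 0 := by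
  have hL : ∀ u v : Z, ‖u‖ ≤ 1 → ‖v‖ ≤ 1 → ‖F u - F v‖ ≤ ‖u - v‖ := by
    intro u v hu hv
    have := hne.dist_le_mul u (by simpa using hu) v (by simpa using hv)
    simpa [dist_eq_norm] using this
  have hS : ∀ y : Ell1, ‖y‖ ≤ 1 → ∃ u : Z, ‖u‖ ≤ 1 ∧ F u = zmk y 0 := by
    intro y hy
    obtain ⟨u, hu, h⟩ := hbij.surjOn (show zmk y 0 ∈ Metric.closedBall 0 1 by
      simpa [aux_norm0] using hy)
    exact ⟨u, by simpa using hu, h⟩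
  have hI : ∀ u v : Z, ‖u‖ ≤ 1 → ‖v‖ ≤ 1 → F u = F v → u = v := fun u v hu hv h =>
    hbij.injOn (by simpa using hu) (by simpa using hv) h
  obtain ⟨u, hu, Fu⟩ := hS (e n) (aux_norm_e n).le
  obtain ⟨v, hv, Fv⟩ := hS (-e n) (by rw [norm_neg, aux_norm_e])
  obtain ⟨w, hw, Fw⟩ := hS (e (n + 1)) (aux_norm_e _).le
  have duv : 2 ≤ ‖u - v‖ := by
    have := hL u v hu hv
    rw [Fu, Fv, aux_sub0, aux_norm0, show e n - -e n = (2 : ℝ) • e n by module, norm_smul,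
      aux_norm_e] at this
    simpa using this
  have duw : 2 ≤ ‖u - w‖ := by
    have := hL u w hu hw
    rw [Fu, Fw, aux_sub0, aux_norm0] at this
    have h2 := aux_dist_e n (n + 1) (by simp) 1 (by simp)
    rw [one_smul] at h2
    linarith
  have dvw : 2 ≤ ‖v - w‖ := by
    have := hL v w hv hw
    rw [Fv, Fw, aux_sub0, aux_norm0] at this
    have h2 := aux_dist_e n (n + 1) (by simp) (-1) (by simp)
    rw [← norm_neg, show -(e n - (-1 : ℝ) • e (n + 1)) = -e n - e (n + 1) by module] at h2
    linarith
  have us : u.snd = 0 := by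
    linarith [aux_B u v hu hv duv, aux_B u w hu hw duw, aux_B v w hv hw dvw]
  have hA : ∀ (z : Z) (c : ℝ), ‖z‖ ≤ 1 → ‖z - u‖ ≤ 1 - c → ‖z - v‖ ≤ 1 + c →
      F z = zmk (c • e n) 0 := by
    intro z c hz h1 h2
    apply aux_A
    · rw [← Fu]; exact (hL _ _ hz hu).trans h1
    · rw [← Fv]; exact (hL _ _ hz hv).trans h2
  have duv' : ‖u - v‖ ≤ 2 := (norm_sub_le _ _).trans (by linarith)
  have huv : v = -u := by
    have mid : ‖(2⁻¹ : ℝ) • (u + v)‖ ≤ 1 := by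
      rw [norm_smul, Real.norm_of_nonneg (by norm_num)]
      linarith [norm_add_le u v]
    have e1 : F ((2⁻¹ : ℝ) • (u + v)) = zmk ((0 : ℝ) • e n) 0 := by
      apply hA _ _ mid
      · rw [show (2⁻¹ : ℝ) • (u + v) - u = (-2⁻¹ : ℝ) • (u - v) by module, norm_smul]
        norm_num; linarith
      · rw [show (2⁻¹ : ℝ) • (u + v) - v = (2⁻¹ : ℝ) • (u - v) by module, norm_smul]
        norm_num; linarith
    have e0 : F 0 = zmk ((0 : ℝ) • e n) 0 := by
      apply hA _ _ (by simp)
      · simpa using hu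
      · simpa using hv
    have h := hI _ _ mid (by simp) (e1.trans e0.symm)
    rw [smul_eq_zero] at h
    rcases h with h | h
    · norm_num at h
    · exact (neg_eq_of_add_eq_zero_right h).symm
  obtain ⟨x, rfl⟩ : ∃ x, u = zmk x 0 := ⟨u.fst, aux_ext rfl us⟩
  have hv' : v = zmk (-x) 0 := by
    rw [huv]; exact aux_ext rfl (by simp [aux_snd])
  subst hv'
  have nx : ‖x‖ = 1 := by
    rw [aux_norm0] at hu
    rw [aux_sub0, aux_norm0, show x - -x = (2 : ℝ) • x by module, norm_smul] at duv
    norm_num at duv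
    linarith
  have hB : ∀ (y : Ell1) (c : ℝ), ‖y‖ ≤ 1 → ‖y - x‖ ≤ 1 - c → ‖y + x‖ ≤ 1 + c →
      F (zmk y 0) = zmk (c • e n) 0 := by
    intro y c hy h1 h2
    apply hA _ _ (by rwa [aux_norm0])
    · rwa [aux_sub0, aux_norm0]
    · rwa [aux_sub0, aux_norm0, sub_neg_eq_add]
  have hC : ∀ c ∈ Set.Icc (-1 : ℝ) 1, F (zmk (c • x) 0) = zmk (c • e n) 0 := by
    rintro c ⟨hc1, hc2⟩
    apply hB
    · rw [norm_smul, nx, mul_one, Real.norm_eq_abs]; exact abs_le.2 ⟨hc1, hc2⟩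
    · rw [show c • x - x = -((1 - c) • x) by module, norm_neg, norm_smul, nx,
        Real.norm_of_nonneg (by linarith), mul_one]
    · rw [show c • x + x = (1 + c) • x by module, norm_smul, nx,
        Real.norm_of_nonneg (by linarith), mul_one]
  obtain ⟨i, hi⟩ : ∃ i, x i ≠ 0 := by
    by_contra! hcon
    have : x = 0 := by ext i; simpa using hcon i
    rw [this] at nx; simp at nx
  have sp := aux_split x i
  rw [nx] at sp
  have habs : 0 < |x i| := abs_pos.2 hi
  have hle : |x i| ≤ 1 := by linarith [norm_nonneg (x - x i • e i)]
  have nxi : ‖x i • e i‖ = |x i| := by rw [norm_smul, aux_norm_e, mul_one, Real.norm_eq_abs]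
  have nw : ‖(2 * x i) • e i - x‖ ≤ 1 := by
    rw [show (2 * x i) • e i - x = x i • e i - (x - x i • e i) by module]
    linarith [norm_sub_le (x i • e i) (x - x i • e i)]
  have f1 : F (zmk ((2 * x i) • e i - x) 0) = zmk ((2 * |x i| - 1) • e n) 0 := by
    apply hB _ _ nw
    · rw [show (2 * x i) • e i - x - x = (-2 : ℝ) • (x - x i • e i) by module, norm_smul, sp]
      norm_num; linarith
    · rw [show (2 * x i) • e i - x + x = (2 : ℝ) • (x i • e i) by module, norm_smul, nxi]
      norm_num
  have hc : 2 * |x i| - 1 ∈ Set.Icc (-1 : ℝ) 1 := ⟨by linarith, by linarith⟩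
  have h := hI _ _ (by rwa [aux_norm0]) (by
    rw [aux_norm0, norm_smul, nx, mul_one, Real.norm_eq_abs]; exact abs_le.2 hc)
    (f1.trans (hC _ hc).symm)
  have h' : (2 * x i) • e i - x = (2 * |x i| - 1) • x := congrArg WithLp.fst h
  have h3 : |x i| • x = x i • e i := by
    have : (2 : ℝ) • (|x i| • x) = (2 : ℝ) • (x i • e i) := by
      rw [show (2 : ℝ) • (|x i| • x) = (2 * |x i| - 1) • x + x by module, ← h']
      module
    exact smul_right_injective _ (two_ne_zero) this
  rcases lt_or_gt_of_ne hi with hneg | hpos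
  · refine ⟨i, -1, Or.inr rfl, fun a ha => ?_⟩
    rw [← hC a ha]
    rw [abs_of_neg hneg] at h3
    have : x = -e i := by
      apply smul_right_injective _ hi
      show x i • x = x i • (-e i)
      rw [smul_neg, ← h3]; module
    rw [this, show (a * -1) • e i = a • (-e i) by module]
  · refine ⟨i, 1, Or.inl rfl, fun a ha => ?_⟩
    rw [← hC a ha]
    rw [abs_of_pos hpos] at h3
    have : x = e i := smul_right_injective _ hi h3
    rw [this, mul_one]

/-- If F is a non-expansive bijection of the closed unit ball of Z = ℓ₁ ⊕₂ ℝ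
onto itself, then there exist an injective map σ : ℕ → ℕ and signs
θ : ℕ → {-1, 1} such that F⁻¹(a·e_m, 0) = (a·θ(m)·e_{σ(m)}, 0) for every m and
every a ∈ [-1, 1]. -/
theorem preimage_of_scaled_basis_vectors_ell1_sum2_real
    (B : Set Z) (hB : B = Metric.closedBall (0 : Z) 1)
    (F : Z → Z) (hbij : Set.BijOn F B B) (hne : LipschitzOnWith 1 F B) :
    ∃ (σ : ℕ → ℕ) (θ : ℕ → ℝ), Function.Injective σ ∧
      (∀ m, θ m = 1 ∨ θ m = -1) ∧
      ∀ m : ℕ, ∀ a ∈ Set.Icc (-1 : ℝ) 1,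
        ∃ w ∈ B, F w = zmk (a • e m) 0 ∧ w = zmk ((a * θ m) • e (σ m)) 0 := by
  subst hB
  choose σ θ hθ hF using aux_main F hbij hne
  have hmem : ∀ m : ℕ, ∀ a ∈ Set.Icc (-1 : ℝ) 1,
      zmk ((a * θ m) • e (σ m)) 0 ∈ Metric.closedBall (0 : Z) 1 := by
    intro m a ha
    have h1 : |θ m| = 1 := by rcases hθ m with h | h <;> simp [h]
    simp only [mem_closedBall_zero_iff]
    rw [aux_norm0, norm_smul, aux_norm_e, mul_one, Real.norm_eq_abs, abs_mul, h1, mul_one]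
    exact abs_le.2 ha
  refine ⟨σ, θ, ?_, hθ, fun m a ha => ⟨_, hmem m a ha, hF m a ha, rfl⟩⟩
  intro m k hmk
  by_contra hne'
  have hk1 : |θ m * θ k| = 1 := by
    rcases hθ m with h | h <;> rcases hθ k with h' | h' <;> simp [h, h']
  have h1 := hF m 1 (by simp)
  have h2 := hF k (θ m * θ k) (by rw [Set.mem_Icc]; exact abs_le.1 hk1.le)
  have hsq : θ m * θ k * θ k = 1 * θ m := by
    rcases hθ k with h' | h' <;> simp [h']
  rw [hsq, ← hmk, h1] at h2
  have h3 : (1 : ℝ) • e m = (θ m * θ k) • e k := congrArg WithLp.fst h2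
  have h4 := aux_dist_e m k hne' (θ m * θ k) hk1
  rw [← h3, one_smul, sub_self, norm_zero] at h4
  norm_num at h4
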